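/- Let G be a finite abelian group, S ⊆ G a nonempty even set with decomposition S·S^{(−1)} = ∑_{H ≤ G} μ_H·H in ℚG (μ_H ∈ ℚ), and Δ : G → Ĝ an isomorphism with adjoint Δ_* and σ = Δ⁻¹ ∘ Δ_*. Let s be the order of the automorphism σ and define, for each subgroup H ≤ G, λ_H := (1/(2s))·∑_{i=0}^{s−1} ( μ_{σ^i(H)} + (|S|/|H|)·μ_{σ^i(Δ⁻¹(H^⊥))} ). Then S is formally self dual under Δ if and only if ∑_{H ≤ G} (μ_H − λ_H)·H = 0 in ℚG. -/

import Mathlib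

open scoped Classical

variable {G : Type*} [CommGroup G] [Fintype G]

/-- The weight enumerator `ν_S(g) = #{(s,t) ∈ S×S : s·t⁻¹ = g}`. -/
noncomputable def nu {A : Type*} [Group A] (S : Finset A) (g : A) : ℕ :=
  Nat.card {p : A × A // p.1 ∈ S ∧ p.2 ∈ S ∧ p.1 * p.2⁻¹ = g}

/-- `S` is formally self dual under the isomorphism `Δ : G → Ĝ`:
`|∑_{s∈S} [Δg](s)|² = |S|·ν_S(g)` for all `g ∈ G`. -/
def FormallySelfDual (Δ : G ≃* (G →* ℂˣ)) (S : Finset G) : Prop :=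
  ∀ g : G, ‖∑ s ∈ S, ((Δ g) s : ℂ)‖ ^ 2 = (S.card : ℝ) * nu S g

/-- The annihilator `H^⊥ = {χ ∈ Ĝ : χ(h) = 1 for all h ∈ H}`. -/
def Subgroup.perpDual (H : Subgroup G) : Subgroup (G →* ℂˣ) where
  carrier := {χ | ∀ h ∈ H, χ h = 1}
  one_mem' := fun h _ => rfl
  mul_mem' := fun {a b} ha hb h hh => by
    rw [MonoidHom.mul_apply, ha h hh, hb h hh, one_mul]
  inv_mem' := fun {a} ha h hh => by
    rw [MonoidHom.inv_apply, ha h hh, inv_one]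

/-- `S = ∑_{g ∈ S} g` as an element of the rational group algebra `ℚG`. -/
noncomputable def fsetElt (S : Finset G) : MonoidAlgebra ℚ G :=
  ∑ g ∈ S, MonoidAlgebra.of ℚ G g

/-- `S^{(-1)} = ∑_{g ∈ S} g⁻¹` as an element of `ℚG`. -/
noncomputable def fsetEltInv (S : Finset G) : MonoidAlgebra ℚ G :=
  ∑ g ∈ S, MonoidAlgebra.of ℚ G g⁻¹

/-- A subgroup `H ≤ G` as the element `∑_{g ∈ H} g` of `ℚG`. -/
noncomputable def sgElt (H : Subgroup G) : MonoidAlgebra ℚ G :=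
  ∑ g : G, if g ∈ H then MonoidAlgebra.of ℚ G g else 0

/-- The coefficient at `g` of the combination `∑ H, a H • H` of subgroups. -/
noncomputable def layerSum (a : Subgroup G → ℚ) (g : G) : ℚ :=
  ∑ H : Subgroup G, if g ∈ H then a H else 0

/-- The subgroup `Δ⁻¹(H^⊥)`. -/
noncomputable def dualSubgroup (Δ : G ≃* (G →* ℂˣ)) (H : Subgroup G) : Subgroup G :=
  H.perpDual.map Δ.symm.toMonoidHom

/-- The coefficient at `g` of `∑ H, (|H| * a H) • Δ⁻¹(H^⊥)`. -/
noncomputable def dualSum (Δ : G ≃* (G →* ℂˣ)) (a : Subgroup G → ℚ) (g : G) : ℚ :=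
  ∑ H : Subgroup G, if g ∈ dualSubgroup Δ H then (Nat.card H : ℚ) * a H else 0

theorem mem_dualSubgroup {A : Type*} [CommGroup A] {Δ : A ≃* (A →* ℂˣ)} {H : Subgroup A} {x : A} :
    x ∈ dualSubgroup Δ H ↔ ∀ h ∈ H, Δ x h = 1 := by
  unfold dualSubgroup
  rw [Subgroup.mem_map]
  constructor
  · rintro ⟨χ, hχ, rfl⟩ h hh
    simpa using hχ h hh
  · intro hx
    exact ⟨Δ x, hx, by simp⟩

theorem coeff_finsum_smul_sgElt (a : Subgroup G → ℚ) (g : G) :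
    (∑ᶠ H : Subgroup G, a H • sgElt H).coeff g = layerSum a g := by
  rw [finsum_eq_sum_of_fintype]
  unfold layerSum sgElt
  simp only [MonoidAlgebra.coeff_sum, MonoidAlgebra.coeff_smul, Finsupp.finsetSum_apply,
    Finsupp.smul_apply, smul_eq_mul]
  refine Finset.sum_congr rfl fun H _ => ?_
  rw [Finset.sum_eq_single g]
  · split_ifs <;> simp
  · intro b _ hb
    split_ifs <;> simp [hb]
  · simp

theorem nu_eq_card_filter (S : Finset G) (g : G) :
    nu S g = ((S ×ˢ S).filter fun p => p.1 * p.2⁻¹ = g).card := by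
  unfold nu
  rw [Nat.card_eq_fintype_card, Fintype.card_subtype]
  congr 1
  ext p
  simp [and_assoc]

theorem coeff_fsetElt_mul_fsetEltInv (S : Finset G) (g : G) :
    (fsetElt S * fsetEltInv S).coeff g = (nu S g : ℚ) := by
  rw [nu_eq_card_filter, Finset.card_filter, Finset.sum_product]
  unfold fsetElt fsetEltInv
  rw [Finset.sum_mul_sum]
  simp [MonoidAlgebra.coeff_sum, Finsupp.finsetSum_apply, Finsupp.single_apply,
    MonoidAlgebra.single_mul_single]

theorem nu_one (S : Finset G) : nu S 1 = S.card := by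
  rw [nu_eq_card_filter, Finset.card_filter, Finset.sum_product]
  simp [mul_inv_eq_one]

theorem sum_character_subgroup (χ : G →* ℂˣ) (H : Subgroup G) :
    ∑ x : G, (if x ∈ H then (χ x : ℂ) else 0) =
      if ∀ h ∈ H, χ h = 1 then (Nat.card H : ℂ) else 0 := by
  have h := sum_hom_units (((Units.coeHom ℂ).comp χ).comp H.subtype)
  rw [← Finset.sum_filter, Finset.sum_subtype (p := (· ∈ H)) _ (by simp)]
  refine h.trans ?_
  rw [Nat.card_eq_fintype_card]
  simp [MonoidHom.ext_iff]

theorem sum_character (χ : G →* ℂˣ) :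
    ∑ x : G, (χ x : ℂ) = if χ = 1 then (Fintype.card G : ℂ) else 0 := by
  simpa [MonoidHom.ext_iff] using sum_character_subgroup χ ⊤

theorem sum_layerSum_mul (Δ : G ≃* (G →* ℂˣ)) (a : Subgroup G → ℚ) (g : G) :
    ∑ x : G, (layerSum a x : ℂ) * (Δ g x : ℂ) = (dualSum Δ a g : ℂ) := by
  unfold layerSum dualSum
  push_cast
  simp_rw [Finset.sum_mul]
  rw [Finset.sum_comm]
  refine Finset.sum_congr rfl fun H _ => ?_
  have h := congrArg ((a H : ℂ) * ·) (sum_character_subgroup (Δ g) H)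
  simp only [Finset.mul_sum] at h
  simp only [mem_dualSubgroup]
  convert h using 1
  · refine Finset.sum_congr rfl fun x _ => ?_
    split_ifs <;> simp
  · split_ifs <;> simp [mul_comm]

theorem norm_sq_sum_character (χ : G →* ℂˣ) (S : Finset G) :
    ((‖∑ s ∈ S, (χ s : ℂ)‖ ^ 2 : ℝ) : ℂ) = ∑ x : G, (nu S x : ℂ) * (χ x : ℂ) := by
  have hconj (x : G) : (starRingEnd ℂ) (χ x : ℂ) = (χ x⁻¹ : ℂ) := by
    have hfin : IsOfFinOrder (χ x : ℂ) :=
      ((Units.coeHom ℂ).comp χ).isOfFinOrder (isOfFinOrder_of_finite x)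
    rw [map_inv, Units.val_inv_eq_inv_val, Complex.inv_eq_conj hfin.norm_eq_one]
  push_cast
  rw [← Complex.mul_conj', map_sum, Finset.sum_mul_sum]
  simp_rw [hconj, ← Units.val_mul, ← map_mul, nu_eq_card_filter, Finset.card_filter]
  push_cast
  simp_rw [Finset.sum_mul]
  rw [Finset.sum_comm (s := Finset.univ), Finset.sum_product]
  refine Finset.sum_congr rfl fun s _ => Finset.sum_congr rfl fun t _ => ?_
  simp

theorem card_dualSubgroup_mul (Δ Δstar : G ≃* (G →* ℂˣ))
    (hadj : ∀ x y : G, (Δstar y) x = (Δ x) y) (H : Subgroup G) :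
    (Nat.card (dualSubgroup Δ H) * Nat.card H : ℚ) = Fintype.card G := by
  have key : ∑ g : G, ∑ x : G, (if x ∈ H then (Δ g x : ℂ) else 0) = Fintype.card G := by
    rw [Finset.sum_comm, Finset.sum_eq_single 1]
    · simp [H.one_mem]
    · intro x _ hx
      have h := sum_character (Δstar x)
      simp only [hadj, EmbeddingLike.map_eq_one_iff, hx, if_false] at h
      split_ifs
      · exact h
      · simp
    · simp
  simp_rw [sum_character_subgroup, ← mem_dualSubgroup] at key
  rw [← Finset.sum_filter, Finset.sum_const, nsmul_eq_mul, ← Fintype.card_subtype,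
    ← Nat.card_eq_fintype_card] at key
  exact_mod_cast key

theorem apply_adjoint_automorphism {A : Type*} [CommGroup A] {Δ Δstar : A ≃* (A →* ℂˣ)}
    (hadj : ∀ x y : A, (Δstar y) x = (Δ x) y) {σ : MulAut A} (hσ : σ = Δstar.trans Δ.symm)
    (x y : A) : Δ (σ x) y = Δ y x := by
  subst hσ
  simp [← hadj]

theorem dualSubgroup_dualSubgroup {Δ Δstar : G ≃* (G →* ℂˣ)}
    (hadj : ∀ x y : G, (Δstar y) x = (Δ x) y) {σ : MulAut G} (hσ : σ = Δstar.trans Δ.symm)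
    (H : Subgroup G) : dualSubgroup Δ (dualSubgroup Δ H) = H.map σ.toMonoidHom := by
  have hap := apply_adjoint_automorphism hadj hσ
  ext x
  obtain ⟨h, rfl⟩ := σ.surjective x
  have hmem : σ h ∈ H.map σ.toMonoidHom ↔ h ∈ H := by
    simp [Subgroup.mem_map]
  rw [hmem, mem_dualSubgroup]
  constructor
  · intro hx
    by_contra hh
    obtain ⟨φ, hφ⟩ := CommGroup.exists_apply_ne_one_of_hasEnoughRootsOfUnity (G ⧸ H) ℂ
      (a := (h : G ⧸ H)) (by rwa [Ne, QuotientGroup.eq_one_iff])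
    refine hφ ?_
    have := hx (Δ.symm (φ.comp (QuotientGroup.mk' H))) (mem_dualSubgroup.2 fun k hk => by
      simp [(QuotientGroup.eq_one_iff k).2 hk])
    simpa [hap] using this
  · intro hh y hy
    rw [hap]
    exact mem_dualSubgroup.1 hy h hh

theorem dualSubgroup_bijective {Δ Δstar : G ≃* (G →* ℂˣ)}
    (hadj : ∀ x y : G, (Δstar y) x = (Δ x) y) {σ : MulAut G} (hσ : σ = Δstar.trans Δ.symm) :
    Function.Bijective (dualSubgroup Δ) := by
  have h : dualSubgroup Δ ∘ dualSubgroup Δ = σ.mapSubgroup := by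
    ext1 H
    exact dualSubgroup_dualSubgroup hadj hσ H
  have hb : Function.Bijective (dualSubgroup Δ ∘ dualSubgroup Δ) := by
    rw [h]
    exact σ.mapSubgroup.bijective
  exact ⟨hb.1.of_comp, hb.2.of_comp⟩

theorem apply_pow_adjoint_automorphism {A : Type*} [CommGroup A] {Δ Δstar : A ≃* (A →* ℂˣ)}
    (hadj : ∀ x y : A, (Δstar y) x = (Δ x) y) {σ : MulAut A} (hσ : σ = Δstar.trans Δ.symm)
    (i : ℕ) (x y : A) : Δ ((σ ^ i) x) ((σ ^ i) y) = Δ x y := by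
  have hap := apply_adjoint_automorphism hadj hσ
  induction i with
  | zero => simp
  | succ n ih => rw [pow_succ', MulAut.mul_apply, MulAut.mul_apply, hap, hap, ih]

theorem mem_map_mulAut {A : Type*} [CommGroup A] {τ : MulAut A} {H : Subgroup A} {x : A} :
    τ x ∈ H.map τ.toMonoidHom ↔ x ∈ H := by
  simp [Subgroup.mem_map]

theorem dualSubgroup_map_pow {A : Type*} [CommGroup A] {Δ Δstar : A ≃* (A →* ℂˣ)}
    (hadj : ∀ x y : A, (Δstar y) x = (Δ x) y) {σ : MulAut A} (hσ : σ = Δstar.trans Δ.symm)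
    (i : ℕ) (H : Subgroup A) :
    dualSubgroup Δ (H.map (σ ^ i).toMonoidHom) =
      (dualSubgroup Δ H).map (σ ^ i).toMonoidHom := by
  ext x
  obtain ⟨y, rfl⟩ := (σ ^ i).surjective x
  rw [mem_map_mulAut, mem_dualSubgroup, mem_dualSubgroup]
  constructor
  · intro h k hk
    rw [← apply_pow_adjoint_automorphism hadj hσ i]
    exact h _ (mem_map_mulAut.2 hk)
  · rintro h _ ⟨k, hk, rfl⟩
    exact (apply_pow_adjoint_automorphism hadj hσ i y k).trans (h k hk)

theorem layerSum_map_mulAut (τ : MulAut G) (a : Subgroup G → ℚ) (g : G) :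
    layerSum (fun H => a (H.map τ.toMonoidHom)) g = layerSum a (τ g) := by
  unfold layerSum
  refine Fintype.sum_equiv τ.mapSubgroup.toEquiv _ _ fun H => ?_
  have : τ g ∈ τ.mapSubgroup H ↔ g ∈ H := mem_map_mulAut
  simp only [RelIso.coe_fn_toEquiv, this]
  rfl

theorem layerSum_dualSubgroup_map {Δ Δstar : G ≃* (G →* ℂˣ)}
    (hadj : ∀ x y : G, (Δstar y) x = (Δ x) y) {σ : MulAut G} (hσ : σ = Δstar.trans Δ.symm)
    (i : ℕ) (c : ℚ) (a : Subgroup G → ℚ) (g : G) :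
    layerSum (fun H => (c / (Nat.card H : ℚ)) *
        a ((dualSubgroup Δ H).map (σ ^ i).toMonoidHom)) g =
      c / (Fintype.card G : ℚ) * dualSum Δ a ((σ ^ (i + 1)) g) := by
  unfold layerSum dualSum
  rw [Finset.mul_sum]
  refine Fintype.sum_bijective _
    ((σ ^ i).mapSubgroup.bijective.comp (dualSubgroup_bijective hadj hσ)) _ _ fun H => ?_
  have hcoe : ((σ ^ i).mapSubgroup ∘ dualSubgroup Δ) H =
      (dualSubgroup Δ H).map (σ ^ i).toMonoidHom := rfl
  have hmem : (σ ^ (i + 1)) g ∈ dualSubgroup Δ ((dualSubgroup Δ H).map (σ ^ i).toMonoidHom) ↔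
      g ∈ H := by
    rw [dualSubgroup_map_pow hadj hσ, dualSubgroup_dualSubgroup hadj hσ, pow_succ,
      MulAut.mul_apply, mem_map_mulAut, mem_map_mulAut]
  have hcard : Nat.card ((dualSubgroup Δ H).map (σ ^ i).toMonoidHom) =
      Nat.card (dualSubgroup Δ H) :=
    (Nat.card_congr ((dualSubgroup Δ H).equivMapOfInjective _ (σ ^ i).injective).toEquiv).symm
  simp only [hcoe, hmem, hcard]
  split_ifs
  · rw [← card_dualSubgroup_mul Δ Δstar hadj H]
    have : (Nat.card H : ℚ) ≠ 0 := by exact_mod_cast Nat.card_pos.ne'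
    have : (Nat.card (dualSubgroup Δ H) : ℚ) ≠ 0 := by exact_mod_cast Nat.card_pos.ne'
    field_simp
  · simp

theorem layerSum_inv (a : Subgroup G → ℚ) (g : G) : layerSum a g⁻¹ = layerSum a g := by
  simp [layerSum]

theorem dualSum_automorphism {Δ Δstar : G ≃* (G →* ℂˣ)}
    (hadj : ∀ x y : G, (Δstar y) x = (Δ x) y) {σ : MulAut G} (hσ : σ = Δstar.trans Δ.symm)
    {a : Subgroup G → ℚ} (ha : ∀ g, layerSum a (σ g) = layerSum a g) (g : G) :
    dualSum Δ a (σ g) = dualSum Δ a g := by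
  have h : (dualSum Δ a (σ g) : ℂ) = dualSum Δ a g := by
    rw [← sum_layerSum_mul, ← sum_layerSum_mul]
    refine (Fintype.sum_equiv σ.toEquiv _ _ fun x => ?_).symm
    have := apply_pow_adjoint_automorphism hadj hσ 1 g x
    rw [pow_one] at this
    change _ = (layerSum a (σ x) : ℂ) * (Δ (σ g) (σ x) : ℂ)
    rw [this, ha]
  exact_mod_cast h

theorem sum_dualSum_mul {Δ Δstar : G ≃* (G →* ℂˣ)}
    (hadj : ∀ x y : G, (Δstar y) x = (Δ x) y) {σ : MulAut G} (hσ : σ = Δstar.trans Δ.symm)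
    (a : Subgroup G → ℚ) (g : G) :
    ∑ x : G, (dualSum Δ a x : ℂ) * (Δ (σ g) x : ℂ) = Fintype.card G * layerSum a g := by
  simp_rw [← sum_layerSum_mul, Finset.sum_mul]
  rw [Finset.sum_comm, Finset.sum_eq_single g⁻¹]
  · simp [apply_adjoint_automorphism hadj hσ, layerSum_inv]
  · intro y _ hy
    have h := sum_character (Δstar (y * g))
    rw [if_neg (by rwa [EmbeddingLike.map_eq_one_iff, mul_eq_one_iff_eq_inv])] at h
    simp_rw [hadj, map_mul, Units.val_mul] at h
    simp_rw [apply_adjoint_automorphism hadj hσ, mul_assoc, ← Finset.mul_sum]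
    rw [h, mul_zero]
  · simp

theorem layerSum_automorphism_of_dualSum_eq {Δ Δstar : G ≃* (G →* ℂˣ)}
    (hadj : ∀ x y : G, (Δstar y) x = (Δ x) y) {σ : MulAut G} (hσ : σ = Δstar.trans Δ.symm)
    {a : Subgroup G → ℚ} {c : ℚ} (h : ∀ g, dualSum Δ a g = c * layerSum a g) (g : G) :
    c ^ 2 * layerSum a (σ g) = Fintype.card G * layerSum a g := by
  have h₁ := sum_dualSum_mul hadj hσ a g
  simp_rw [h] at h₁
  push_cast at h₁
  simp_rw [mul_assoc, ← Finset.mul_sum] at h₁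
  rw [sum_layerSum_mul, h] at h₁
  push_cast at h₁
  rw [pow_two, mul_assoc]
  exact_mod_cast h₁

theorem formallySelfDual_iff {S : Finset G} {Δ : G ≃* (G →* ℂˣ)} {a : Subgroup G → ℚ}
    (ha : ∀ g, layerSum a g = nu S g) :
    FormallySelfDual Δ S ↔ ∀ g, dualSum Δ a g = S.card * layerSum a g := by
  refine forall_congr' fun g => ?_
  have h : ((‖∑ s ∈ S, (Δ g s : ℂ)‖ ^ 2 : ℝ) : ℂ) = dualSum Δ a g := by
    rw [norm_sq_sum_character, ← sum_layerSum_mul]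
    simp [ha]
  rw [← Complex.ofReal_inj, h, ha]
  push_cast
  norm_cast

theorem sum_range_orderOf_apply {α : Type*} [Group α] (σ : MulAut α) (w : α → ℚ) (g : α) :
    ∑ i ∈ Finset.range (orderOf σ), w ((σ ^ i) (σ g)) =
      ∑ i ∈ Finset.range (orderOf σ), w ((σ ^ i) g) := by
  have h := Finset.sum_range_succ (fun i => w ((σ ^ i) g)) (orderOf σ)
  rw [Finset.sum_range_succ'] at h
  simpa [pow_orderOf_eq_one, pow_succ] using h

theorem apply_pow_of_apply {α : Type*} [Group α] {σ : MulAut α} {w : α → ℚ}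
    (h : ∀ g, w (σ g) = w g) (i : ℕ) (g : α) : w ((σ ^ i) g) = w g := by
  induction i with
  | zero => simp
  | succ n ih => rw [pow_succ', MulAut.mul_apply, h, ih]

theorem stmt5 (S : Finset G) (hS : S.Nonempty) (Δ Δstar : G ≃* (G →* ℂˣ))
    (hadj : ∀ x y : G, (Δstar y) x = (Δ x) y)
    (μ : Subgroup G → ℚ)
    (hdecomp : fsetElt S * fsetEltInv S = ∑ᶠ H : Subgroup G, μ H • sgElt H) :
    let σ : MulAut G := Δstar.trans Δ.symm
    let s : ℕ := orderOf σ
    let lam : Subgroup G → ℚ := fun H =>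
      (1 / (2 * (s : ℚ))) * ∑ i ∈ Finset.range s,
        (μ (H.map (σ ^ i).toMonoidHom)
          + ((S.card : ℚ) / (Nat.card H : ℚ))
            * μ ((H.perpDual.map Δ.symm.toMonoidHom).map (σ ^ i).toMonoidHom))
    (FormallySelfDual Δ S ↔ (∑ᶠ H : Subgroup G, (μ H - lam H) • sgElt H) = 0) := by
  intro σ s lam
  have hσ : σ = Δstar.trans Δ.symm := rfl
  have hs : (s : ℚ) ≠ 0 := by exact_mod_cast (orderOf_pos σ).ne'
  have hnu : ∀ g, layerSum μ g = nu S g := fun g => by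
    rw [← coeff_finsum_smul_sgElt, ← hdecomp, coeff_fsetElt_mul_fsetEltInv]
  have hone : layerSum μ 1 = S.card := by rw [hnu, nu_one]
  have hcS : (S.card : ℚ) ≠ 0 := by exact_mod_cast hS.card_pos.ne'
  have hcG : (Fintype.card G : ℚ) ≠ 0 := by exact_mod_cast Fintype.card_ne_zero
  have hlam (g : G) : layerSum lam g = 1 / (2 * (s : ℚ)) * ∑ i ∈ Finset.range s,
      (layerSum μ ((σ ^ i) g) +
        S.card / Fintype.card G * dualSum Δ μ ((σ ^ i) (σ g))) := by
    simp_rw [← MulAut.mul_apply, ← pow_succ, ← layerSum_dualSubgroup_map hadj hσ,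
      ← layerSum_map_mulAut]
    simp only [layerSum, ← Finset.sum_add_distrib]
    rw [Finset.sum_comm, Finset.mul_sum]
    refine Finset.sum_congr rfl fun H _ => ?_
    split_ifs
    · rfl
    · simp
  have hzero : (∑ᶠ H : Subgroup G, (μ H - lam H) • sgElt H) = 0 ↔
      ∀ g, layerSum μ g = layerSum lam g := by
    rw [← MonoidAlgebra.coeff_inj, Finsupp.ext_iff]
    refine forall_congr' fun g => ?_
    rw [coeff_finsum_smul_sgElt, ← sub_eq_zero (a := layerSum μ g)]
    simp only [layerSum, ← Finset.sum_sub_distrib, MonoidAlgebra.coeff_zero, Finsupp.zero_apply]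
    refine Eq.congr (Finset.sum_congr rfl fun H _ => ?_) rfl
    split_ifs <;> simp
  have havg (hinv : ∀ g, layerSum μ (σ g) = layerSum μ g) (g : G) :
      layerSum lam g =
        (layerSum μ g + S.card / Fintype.card G * dualSum Δ μ g) / 2 := by
    have hinv' := dualSum_automorphism hadj hσ hinv
    rw [hlam]
    simp only [apply_pow_of_apply hinv, apply_pow_of_apply hinv', hinv', Finset.sum_const,
      Finset.card_range, nsmul_eq_mul]
    field_simp
  rw [formallySelfDual_iff hnu, hzero]
  constructor
  · intro h
    have hσ' := layerSum_automorphism_of_dualSum_eq hadj hσ h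
    have hsq : (S.card : ℚ) ^ 2 = Fintype.card G := by
      have := hσ' 1
      rw [map_one, hone] at this
      exact mul_right_cancel₀ hcS this
    have hinv (g : G) : layerSum μ (σ g) = layerSum μ g :=
      mul_left_cancel₀ hcG (by rw [← hσ' g, hsq])
    intro g
    rw [havg hinv, h, ← hsq]
    field_simp
    ring
  · intro h
    have hinv (g : G) : layerSum μ (σ g) = layerSum μ g := by
      rw [h, h, hlam, hlam]
      congr 1
      simp only [Finset.sum_add_distrib]
      congr 1
      · exact sum_range_orderOf_apply σ (layerSum μ) g
      · exact sum_range_orderOf_apply σ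
          (fun x => S.card / Fintype.card G * dualSum Δ μ x) (σ g)
    have hfix (g : G) : layerSum μ g = S.card / Fintype.card G * dualSum Δ μ g := by
      have := h g
      rw [havg hinv] at this
      linarith
    have hdual_one : dualSum Δ μ 1 = (S.card : ℚ) ^ 2 := by
      have := (norm_sq_sum_character (Δ 1) S).trans
        ((Finset.sum_congr rfl fun x _ => by rw [hnu]; simp).trans (sum_layerSum_mul Δ μ 1))
      simp at this
      exact_mod_cast this.symm
    have hsq : (S.card : ℚ) ^ 2 = Fintype.card G := by
      have := hfix 1
      rw [hone, hdual_one] at this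
      field_simp at this
      exact this.symm
    intro g
    rw [hfix g, ← hsq]
    field_simp
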